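/- arXiv:0910.1947 — 5 statements merged into one kernel-verified Lean document; each statement's English description precedes it below -/
import Mathlib

section
/- For all real sequences x = (x_j) and y = (y_j) in V(λ;p), the functional h satisfies the triangle inequality: h(x+y) ≤ h(x) + h(y); that is, (∑_{k=1}^∞ ((1/λ_k) ∑_{j∈I_k} |x_j + y_j|)^{p_k})^{1/M} ≤ (∑_{k=1}^∞ ((1/λ_k) ∑_{j∈I_k} |x_j|)^{p_k})^{1/M} + (∑_{k=1}^∞ ((1/λ_k) ∑_{j∈I_k} |y_j|)^{p_k})^{1/M}. -/
open Filter
open scoped BigOperators ENNReal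

/-- The index window `I_k = {j ∈ ℤ : k - λ_k + 1 ≤ j ≤ k}` of the
de la Vallée-Poussin mean (indices are positive integers). -/
noncomputable def vpWindow (lam : ℕ → ℝ) (k : ℕ) : Finset ℕ :=
  (Finset.Icc 1 k).filter fun j => (k : ℝ) - lam k + 1 ≤ (j : ℝ)

/-- The modular `ρ(x) = ∑_{k≥1} ((1/λ_k) ∑_{j ∈ I_k} |x_j|)^{p_k}`,
valued in `ℝ≥0∞` (so that `ρ(x) < ∞` is meaningful). -/
noncomputable def vpModular (lam pp : ℕ → ℝ) (x : ℕ → ℝ) : ℝ≥0∞ :=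
  ∑' k : ℕ, ENNReal.ofReal
    (((lam (k + 1))⁻¹ * ∑ j ∈ vpWindow lam (k + 1), |x j|) ^ pp (k + 1))

/-- The paranorm `h(x) = ρ(x)^{1/M}`. -/
noncomputable def vpParanorm (lam pp : ℕ → ℝ) (M : ℝ) (x : ℕ → ℝ) : ℝ :=
  (vpModular lam pp x).toReal ^ (1 / M)

/-- The de la Vallée-Poussin mean `(1/λ_k) ∑_{j ∈ I_k} |x_j|`. -/
noncomputable def vpMean (lam : ℕ → ℝ) (k : ℕ) (x : ℕ → ℝ) : ℝ :=
  (lam k)⁻¹ * ∑ j ∈ vpWindow lam k, |x j|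

lemma vpMean_nonneg {lam : ℕ → ℝ} {k : ℕ} (hk : 0 ≤ lam k) (x : ℕ → ℝ) :
    0 ≤ vpMean lam k x :=
  mul_nonneg (inv_nonneg.2 hk) (Finset.sum_nonneg fun _ _ => abs_nonneg _)

lemma vpMean_add_le {lam : ℕ → ℝ} {k : ℕ} (hk : 0 ≤ lam k) (x y : ℕ → ℝ) :
    vpMean lam k (x + y) ≤ vpMean lam k x + vpMean lam k y := by
  unfold vpMean
  rw [← mul_add, ← Finset.sum_add_distrib]
  exact mul_le_mul_of_nonneg_left (Finset.sum_le_sum fun j _ => abs_add_le (x j) (y j))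
    (inv_nonneg.2 hk)

lemma toReal_vpModular {lam : ℕ → ℝ} (hlam : ∀ k, 0 ≤ lam (k + 1)) (pp x : ℕ → ℝ) :
    (vpModular lam pp x).toReal = ∑' k, vpMean lam (k + 1) x ^ pp (k + 1) := by
  unfold vpModular
  rw [ENNReal.tsum_toReal_eq fun _ => ENNReal.ofReal_ne_top]
  exact tsum_congr fun k =>
    ENNReal.toReal_ofReal (Real.rpow_nonneg (vpMean_nonneg (hlam k) x) _)

lemma summable_vpMean_rpow {lam : ℕ → ℝ} (hlam : ∀ k, 0 ≤ lam (k + 1)) {pp x : ℕ → ℝ}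
    (hx : vpModular lam pp x < ⊤) :
    Summable fun k => vpMean lam (k + 1) x ^ pp (k + 1) :=
  (ENNReal.summable_toReal hx.ne).congr fun k =>
    ENNReal.toReal_ofReal (Real.rpow_nonneg (vpMean_nonneg (hlam k) x) _)

/-- Minkowski's inequality with variable exponents `0 ≤ q i ≤ M`, where `1 ≤ M`. -/
lemma tsum_rpow_rpow_inv_le_add {ι : Type*} {a b c q : ι → ℝ} {M : ℝ} (hM : 1 ≤ M)
    (hq : ∀ i, 0 ≤ q i) (hqM : ∀ i, q i ≤ M) (ha : ∀ i, 0 ≤ a i) (hb : ∀ i, 0 ≤ b i)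
    (hc : ∀ i, 0 ≤ c i) (hcab : ∀ i, c i ≤ a i + b i)
    (ha_sum : Summable fun i => a i ^ q i) (hb_sum : Summable fun i => b i ^ q i) :
    (∑' i, c i ^ q i) ^ (1 / M) ≤
      (∑' i, a i ^ q i) ^ (1 / M) + (∑' i, b i ^ q i) ^ (1 / M) := by
  have hM0 : 0 < M := one_pos.trans_le hM
  have hpow {t : ℝ} (ht : 0 ≤ t) (i : ι) : (t ^ (q i / M)) ^ M = t ^ q i := by
    rw [← Real.rpow_mul ht, div_mul_cancel₀ _ hM0.ne']
  have hquot (i : ι) : 0 ≤ q i / M := div_nonneg (hq i) hM0.le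
  have hle (i : ι) : c i ^ q i ≤ (a i ^ (q i / M) + b i ^ (q i / M)) ^ M := by
    rw [← hpow (hc i)]
    refine Real.rpow_le_rpow (Real.rpow_nonneg (hc i) _) ?_ hM0.le
    exact (Real.rpow_le_rpow (hc i) (hcab i) (hquot i)).trans
      (Real.rpow_add_le_add_rpow (ha i) (hb i) (hquot i) ((div_le_one hM0).2 (hqM i)))
  obtain ⟨hsum, hmink⟩ := Real.Lp_add_le_tsum_of_nonneg hM
    (fun i => Real.rpow_nonneg (ha i) (q i / M)) (fun i => Real.rpow_nonneg (hb i) (q i / M))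
    (ha_sum.congr fun i => (hpow (ha i) i).symm) (hb_sum.congr fun i => (hpow (hb i) i).symm)
  simp only [hpow (ha _), hpow (hb _)] at hmink
  have hc_pow (i : ι) : 0 ≤ c i ^ q i := Real.rpow_nonneg (hc i) _
  refine le_trans (Real.rpow_le_rpow (tsum_nonneg hc_pow) ?_ (by positivity)) hmink
  exact (hsum.of_nonneg_of_le hc_pow hle).tsum_le_tsum hle hsum

/-- The paranorm `h` on `V(λ;p)` satisfies the triangle inequality. -/
theorem vpParanorm_triangle (lam pp : ℕ → ℝ) (H M : ℝ)
    (hlam1 : lam 1 = 1)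
    (hlam_pos : ∀ k : ℕ, 1 ≤ k → 0 < lam k)
    (hlam_mono : ∀ k : ℕ, 1 ≤ k → lam k ≤ lam (k + 1))
    (hlam_step : ∀ k : ℕ, 1 ≤ k → lam (k + 1) ≤ lam k + 1)
    (hlam_top : Tendsto lam atTop atTop)
    (hp_gt : ∀ k : ℕ, 1 ≤ k → 1 < pp k)
    (hp_bdd : BddAbove (Set.range fun k : ℕ => pp (k + 1)))
    (hH : H = ⨆ k : ℕ, pp (k + 1)) (hM : M = max 1 H)
    (x y : ℕ → ℝ)
    (hx : vpModular lam pp x < ⊤) (hy : vpModular lam pp y < ⊤) :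
    vpParanorm lam pp M (x + y) ≤ vpParanorm lam pp M x + vpParanorm lam pp M y := by
  have hlam (k : ℕ) : 0 ≤ lam (k + 1) := (hlam_pos (k + 1) k.succ_pos).le
  unfold vpParanorm
  simp only [toReal_vpModular hlam]
  refine tsum_rpow_rpow_inv_le_add (hM ▸ le_max_left 1 H)
    (fun k => (one_pos.trans (hp_gt (k + 1) k.succ_pos)).le) (fun k => ?_)
    (fun k => vpMean_nonneg (hlam k) x) (fun k => vpMean_nonneg (hlam k) y)
    (fun k => vpMean_nonneg (hlam k) (x + y)) (fun k => vpMean_add_le (hlam k) x y)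
    (summable_vpMean_rpow hlam hx) (summable_vpMean_rpow hlam hy)
  rw [hM, hH]
  exact (le_ciSup hp_bdd k).trans (le_max_right _ _)
end

section
/- The space V(λ;p) is complete with respect to the paranorm h: if (x^n) is a sequence of elements of V(λ;p) such that h(x^n − x^m) → 0 as m, n → ∞ (a Cauchy sequence for the metric induced by h), then there exists x ∈ V(λ;p) with h(x^n − x) → 0 as n → ∞. -/
open Filter
open scoped BigOperators ENNReal

/-- A single summand of `vpModular`, before coercion to `ℝ≥0∞`. -/
noncomputable def vpTerm (lam pp : ℕ → ℝ) (k : ℕ) (x : ℕ → ℝ) : ℝ :=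
  ((lam (k + 1))⁻¹ * ∑ j ∈ vpWindow lam (k + 1), |x j|) ^ pp (k + 1)

theorem vpModular_eq_tsum_vpTerm (lam pp x : ℕ → ℝ) :
    vpModular lam pp x = ∑' k, ENNReal.ofReal (vpTerm lam pp k x) := rfl

theorem vpTerm_sub_le {lam pp : ℕ → ℝ} {k : ℕ} {H : ℝ} (hlam : 0 < lam (k + 1))
    (hp : 1 < pp (k + 1)) (hH : pp (k + 1) ≤ H) (x y : ℕ → ℝ) :
    vpTerm lam pp k (x - y) ≤ 2 ^ H * (vpTerm lam pp k x + vpTerm lam pp k y) := by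
  unfold vpTerm
  set W := vpWindow lam (k + 1)
  have hnn : ∀ z : ℕ → ℝ, 0 ≤ (lam (k + 1))⁻¹ * ∑ j ∈ W, |z j| := fun z => by positivity
  have hle : (lam (k + 1))⁻¹ * ∑ j ∈ W, |(x - y) j| ≤
      (lam (k + 1))⁻¹ * ∑ j ∈ W, |x j| + (lam (k + 1))⁻¹ * ∑ j ∈ W, |y j| := by
    rw [← mul_add, ← Finset.sum_add_distrib]
    gcongr with j
    exact abs_sub _ _
  calc _ ≤ _ := Real.rpow_le_rpow (hnn _) hle (by linarith)
    _ ≤ 2 ^ (pp (k + 1) - 1) * (((lam (k + 1))⁻¹ * ∑ j ∈ W, |x j|) ^ pp (k + 1) +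
        ((lam (k + 1))⁻¹ * ∑ j ∈ W, |y j|) ^ pp (k + 1)) := by
      exact_mod_cast NNReal.rpow_add_le_mul_rpow_add_rpow ⟨_, hnn x⟩ ⟨_, hnn y⟩ hp.le
    _ ≤ _ := by
      gcongr
      · norm_num
      · linarith

theorem vpModular_sub_le {lam pp : ℕ → ℝ} {H : ℝ} (hlam : ∀ k, 1 ≤ k → 0 < lam k)
    (hp : ∀ k, 1 ≤ k → 1 < pp k) (hH : ∀ k, pp (k + 1) ≤ H) (x y : ℕ → ℝ) :
    vpModular lam pp (x - y) ≤
      ENNReal.ofReal (2 ^ H) * (vpModular lam pp x + vpModular lam pp y) := by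
  simp only [vpModular_eq_tsum_vpTerm]
  rw [← ENNReal.tsum_add, ← ENNReal.tsum_mul_left]
  refine ENNReal.tsum_le_tsum fun k => ?_
  have hnn : ∀ z, 0 ≤ vpTerm lam pp k z := fun z => by
    have := hlam (k + 1) (by omega)
    unfold vpTerm
    positivity
  rw [← ENNReal.ofReal_add (hnn x) (hnn y), ← ENNReal.ofReal_mul (by positivity)]
  exact ENNReal.ofReal_le_ofReal
    (vpTerm_sub_le (hlam _ (by omega)) (hp _ (by omega)) (hH k) x y)

theorem tendsto_vpTerm {lam pp : ℕ → ℝ} {k : ℕ} (hp : 0 ≤ pp (k + 1))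
    {u : ℕ → ℕ → ℝ} {x : ℕ → ℝ}
    (hu : ∀ j, 1 ≤ j → Tendsto (fun n => u n j) atTop (nhds (x j))) :
    Tendsto (fun n => vpTerm lam pp k (u n)) atTop (nhds (vpTerm lam pp k x)) := by
  unfold vpTerm
  refine Tendsto.rpow_const (Tendsto.const_mul _ (tendsto_finsetSum _ fun j hj => ?_)) (Or.inr hp)
  refine (hu j ?_).abs
  simp only [vpWindow, Finset.mem_filter, Finset.mem_Icc] at hj
  exact hj.1.1

/-- Lower semicontinuity of the modular under coordinatewise convergence. -/
theorem vpModular_le_of_tendsto {lam pp : ℕ → ℝ} (hp : ∀ k, 1 ≤ k → 1 < pp k)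
    {u : ℕ → ℕ → ℝ} {x : ℕ → ℝ} {c : ℝ≥0∞}
    (hu : ∀ j, 1 ≤ j → Tendsto (fun n => u n j) atTop (nhds (x j)))
    (hc : ∀ᶠ n in atTop, vpModular lam pp (u n) ≤ c) : vpModular lam pp x ≤ c := by
  rw [vpModular_eq_tsum_vpTerm, ENNReal.tsum_eq_iSup_sum]
  refine iSup_le fun s => ?_
  have ht : Tendsto (fun n => ∑ k ∈ s, ENNReal.ofReal (vpTerm lam pp k (u n))) atTop
      (nhds (∑ k ∈ s, ENNReal.ofReal (vpTerm lam pp k x))) :=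
    tendsto_finsetSum _ fun k _ => ENNReal.tendsto_ofReal
      (tendsto_vpTerm (by linarith [hp (k + 1) (by omega)]) hu)
  refine le_of_tendsto ht (hc.mono fun n hn => le_trans ?_ hn)
  exact ENNReal.sum_le_tsum s

theorem abs_lt_of_vpModular_lt {lam pp : ℕ → ℝ} {k : ℕ} (hlam : 1 ≤ lam (k + 1))
    (hp : 1 < pp (k + 1)) {x : ℕ → ℝ} {ε : ℝ} (hε : 0 < ε)
    (h : vpModular lam pp x < ENNReal.ofReal (((lam (k + 1))⁻¹ * ε) ^ pp (k + 1))) :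
    |x (k + 1)| < ε := by
  have hpos : 0 < lam (k + 1) := by linarith
  have hterm : ENNReal.ofReal (vpTerm lam pp k x) ≤ vpModular lam pp x :=
    ENNReal.le_tsum (f := fun k => ENNReal.ofReal (vpTerm lam pp k x)) k
  have hlt := (ENNReal.ofReal_lt_ofReal_iff (by positivity)).1 (hterm.trans_lt h)
  unfold vpTerm at hlt
  rw [Real.rpow_lt_rpow_iff (by positivity) (by positivity) (by linarith)] at hlt
  have hsum := lt_of_mul_lt_mul_left hlt (by positivity)
  refine lt_of_le_of_lt ?_ hsum
  refine Finset.single_le_sum (f := fun j => |x j|) (fun j _ => abs_nonneg _) ?_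
  simp only [vpWindow, Finset.mem_filter, Finset.mem_Icc]
  exact ⟨⟨by omega, le_rfl⟩, by linarith⟩

/-- `V(λ;p)` is complete with respect to the paranorm `h`. -/
theorem vpParanorm_complete (lam pp : ℕ → ℝ) (H M : ℝ)
    (hlam1 : lam 1 = 1)
    (hlam_pos : ∀ k : ℕ, 1 ≤ k → 0 < lam k)
    (hlam_mono : ∀ k : ℕ, 1 ≤ k → lam k ≤ lam (k + 1))
    (hlam_step : ∀ k : ℕ, 1 ≤ k → lam (k + 1) ≤ lam k + 1)
    (hlam_top : Tendsto lam atTop atTop)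
    (hp_gt : ∀ k : ℕ, 1 ≤ k → 1 < pp k)
    (hp_bdd : BddAbove (Set.range fun k : ℕ => pp (k + 1)))
    (hH : H = ⨆ k : ℕ, pp (k + 1)) (hM : M = max 1 H)
    (xs : ℕ → ℕ → ℝ) (hxs : ∀ n, vpModular lam pp (xs n) < ⊤)
    (hcauchy : ∀ ε : ℝ, 0 < ε → ∃ N : ℕ, ∀ m n : ℕ, N ≤ m → N ≤ n →
      vpParanorm lam pp M (xs n - xs m) < ε) :
    ∃ x : ℕ → ℝ, vpModular lam pp x < ⊤ ∧
      Tendsto (fun n => vpParanorm lam pp M (xs n - x)) atTop (nhds 0) := by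
  have hpH : ∀ k, pp (k + 1) ≤ H := fun k => hH ▸ le_ciSup hp_bdd k
  have hM0 : 0 < M := by rw [hM]; positivity
  have hlam_ge : ∀ k, 1 ≤ lam (k + 1) := by
    intro k
    induction k with
    | zero => simp [hlam1]
    | succ k ih => exact ih.trans (hlam_mono (k + 1) (by omega))
  have hsub : ∀ {x y : ℕ → ℝ}, vpModular lam pp x < ⊤ → vpModular lam pp y < ⊤ →
      vpModular lam pp (x - y) < ⊤ := fun hx hy =>
    (vpModular_sub_le hlam_pos hp_gt hpH _ _).trans_lt
      (ENNReal.mul_lt_top ENNReal.ofReal_lt_top (ENNReal.add_lt_top.2 ⟨hx, hy⟩))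
  have hmod : ∀ δ : ℝ, 0 < δ → ∃ N : ℕ, ∀ m n : ℕ, N ≤ m → N ≤ n →
      vpModular lam pp (xs n - xs m) < ENNReal.ofReal δ := by
    intro δ hδ
    obtain ⟨N, hN⟩ := hcauchy (δ ^ (1 / M)) (by positivity)
    refine ⟨N, fun m n hm hn => ?_⟩
    have h := hN m n hm hn
    unfold vpParanorm at h
    rw [Real.rpow_lt_rpow_iff ENNReal.toReal_nonneg hδ.le (by positivity)] at h
    exact (ENNReal.lt_ofReal_iff_toReal_lt (hsub (hxs n) (hxs m)).ne).2 h
  have hcoord : ∀ j, ∃ l : ℝ, 1 ≤ j → Tendsto (fun n => xs n j) atTop (nhds l) := by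
    intro j
    rcases j with _ | k
    · exact ⟨0, by simp⟩
    have hc : CauchySeq fun n => xs n (k + 1) := by
      rw [Metric.cauchySeq_iff]
      intro ε hε
      have := hlam_pos (k + 1) (by omega)
      obtain ⟨N, hN⟩ := hmod (((lam (k + 1))⁻¹ * ε) ^ pp (k + 1)) (by positivity)
      refine ⟨N, fun m hm n hn => ?_⟩
      exact abs_lt_of_vpModular_lt (hlam_ge k) (hp_gt _ (by omega)) hε (hN n m hn hm)
    obtain ⟨l, hl⟩ := cauchySeq_tendsto_of_complete hc
    exact ⟨l, fun _ => hl⟩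
  choose x hx using hcoord
  have hlim : ∀ δ : ℝ, 0 < δ → ∃ N : ℕ, ∀ n : ℕ, N ≤ n →
      vpModular lam pp (xs n - x) ≤ ENNReal.ofReal δ := by
    intro δ hδ
    obtain ⟨N, hN⟩ := hmod δ hδ
    refine ⟨N, fun n hn => vpModular_le_of_tendsto hp_gt (u := fun m => xs n - xs m)
      (fun j hj => tendsto_const_nhds.sub (hx j hj)) ?_⟩
    filter_upwards [eventually_ge_atTop N] with m hm
    exact (hN m n hm hn).le
  refine ⟨x, ?_, ?_⟩
  · obtain ⟨N, hN⟩ := hlim 1 one_pos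
    have h := hsub (hxs N) ((hN N le_rfl).trans_lt ENNReal.ofReal_lt_top)
    rwa [sub_sub_cancel] at h
  · have h0 : Tendsto (fun n => (vpModular lam pp (xs n - x)).toReal) atTop (nhds 0) := by
      rw [Metric.tendsto_atTop]
      intro ε hε
      obtain ⟨N, hN⟩ := hlim (ε / 2) (by positivity)
      refine ⟨N, fun n hn => ?_⟩
      rw [Real.dist_0_eq_abs, abs_of_nonneg ENNReal.toReal_nonneg]
      exact (ENNReal.toReal_le_of_le_ofReal (by positivity) (hN n hn)).trans_lt (half_lt_self hε)
    have h := h0.rpow_const (p := 1 / M) (Or.inr (by positivity))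
    rwa [Real.zero_rpow (by positivity)] at h
end

section
/- For constant exponent p with 1 < p < ∞, the space V_p(λ) is complete with respect to the norm ‖·‖_{V_p(λ)}: if (x^n) is a sequence in V_p(λ) with ‖x^n − x^m‖_{V_p(λ)} → 0 as m, n → ∞, then there exists x ∈ V_p(λ) with ‖x^n − x‖_{V_p(λ)} → 0 as n → ∞. -/
open Filter
open scoped BigOperators ENNReal

/-- For constant exponent `p`: `∑_{k≥1} ((1/λ_k) ∑_{j ∈ I_k} |x_j|)^p`, in `ℝ≥0∞`. -/
noncomputable def vpSum (lam : ℕ → ℝ) (p : ℝ) (x : ℕ → ℝ) : ℝ≥0∞ :=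
  ∑' k : ℕ, ENNReal.ofReal
    (((lam (k + 1))⁻¹ * ∑ j ∈ vpWindow lam (k + 1), |x j|) ^ p)

/-- The norm of `V_p(λ)`. -/
noncomputable def vpNorm (lam : ℕ → ℝ) (p : ℝ) (x : ℕ → ℝ) : ℝ :=
  (vpSum lam p x).toReal ^ (1 / p)

/-- The quasi-triangle inequality for the modular. -/
theorem vpSum_sub_le {lam : ℕ → ℝ} {p : ℝ} (hlam : ∀ k : ℕ, 1 ≤ k → 0 < lam k) (hp : 1 ≤ p)
    (x y : ℕ → ℝ) :
    vpSum lam p (x - y) ≤ 2 ^ (p - 1) * (vpSum lam p x + vpSum lam p y) := by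
  unfold vpSum
  rw [← ENNReal.tsum_add, ← ENNReal.tsum_mul_left]
  refine ENNReal.tsum_le_tsum fun k => ?_
  have hl : 0 ≤ (lam (k + 1))⁻¹ := (inv_pos.2 (hlam _ k.succ_pos)).le
  have hmean : ∀ z : ℕ → ℝ, 0 ≤ (lam (k + 1))⁻¹ * ∑ j ∈ vpWindow lam (k + 1), |z j| :=
    fun z => mul_nonneg hl (Finset.sum_nonneg fun j _ => abs_nonneg _)
  have hp0 : 0 ≤ p := zero_le_one.trans hp
  rw [← ENNReal.ofReal_rpow_of_nonneg (hmean _) hp0, ← ENNReal.ofReal_rpow_of_nonneg (hmean x) hp0,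
    ← ENNReal.ofReal_rpow_of_nonneg (hmean y) hp0]
  refine le_trans ?_ (ENNReal.rpow_add_le_mul_rpow_add_rpow _ _ hp)
  refine ENNReal.rpow_le_rpow ?_ hp0
  rw [← ENNReal.ofReal_add (hmean x) (hmean y), ← mul_add, ← Finset.sum_add_distrib]
  exact ENNReal.ofReal_le_ofReal
    (mul_le_mul_of_nonneg_left (Finset.sum_le_sum fun j _ => abs_sub (x j) (y j)) hl)

theorem vpSum_sub_lt_top {lam : ℕ → ℝ} {p : ℝ} (hlam : ∀ k : ℕ, 1 ≤ k → 0 < lam k) (hp : 1 ≤ p)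
    {x y : ℕ → ℝ} (hx : vpSum lam p x < ⊤) (hy : vpSum lam p y < ⊤) :
    vpSum lam p (x - y) < ⊤ :=
  (vpSum_sub_le hlam hp x y).trans_lt <| ENNReal.mul_lt_top
    (ENNReal.rpow_lt_top_of_nonneg (by linarith) (by simp)) (ENNReal.add_lt_top.2 ⟨hx, hy⟩)

theorem vpSum_eq_ofReal_vpNorm_rpow {lam : ℕ → ℝ} {p : ℝ} (hp : 0 < p) {x : ℕ → ℝ}
    (hx : vpSum lam p x < ⊤) : vpSum lam p x = ENNReal.ofReal (vpNorm lam p x ^ p) := by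
  rw [vpNorm, ← Real.rpow_mul ENNReal.toReal_nonneg, one_div_mul_cancel hp.ne', Real.rpow_one,
    ENNReal.ofReal_toReal hx.ne]

theorem vpNorm_nonneg (lam : ℕ → ℝ) (p : ℝ) (x : ℕ → ℝ) : 0 ≤ vpNorm lam p x :=
  Real.rpow_nonneg ENNReal.toReal_nonneg _

theorem vpNorm_le_of_vpSum_le {lam : ℕ → ℝ} {p : ℝ} (hp : 0 < p) {x : ℕ → ℝ} {c : ℝ}
    (hc : 0 ≤ c) (h : vpSum lam p x ≤ ENNReal.ofReal (c ^ p)) : vpNorm lam p x ≤ c := by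
  have hx : vpSum lam p x < ⊤ := h.trans_lt ENNReal.ofReal_lt_top
  rw [vpSum_eq_ofReal_vpNorm_rpow hp hx,
    ENNReal.ofReal_le_ofReal_iff (Real.rpow_nonneg hc p)] at h
  exact (Real.rpow_le_rpow_iff (vpNorm_nonneg _ _ _) hc hp).1 h

/-- Each coordinate is controlled by the norm. -/
theorem abs_le_mul_vpNorm {lam : ℕ → ℝ} {p : ℝ} (hp : 0 < p) {x : ℕ → ℝ}
    (hx : vpSum lam p x < ⊤) {j : ℕ} (hj : 1 ≤ j) (hlam : 1 ≤ lam j) :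
    |x j| ≤ lam j * vpNorm lam p x := by
  obtain ⟨k, rfl⟩ : ∃ k, j = k + 1 := ⟨j - 1, by omega⟩
  have hl : 0 < lam (k + 1) := zero_lt_one.trans_le hlam
  have hterm := ENNReal.le_tsum (f := fun k : ℕ => ENNReal.ofReal
    (((lam (k + 1))⁻¹ * ∑ j ∈ vpWindow lam (k + 1), |x j|) ^ p)) k
  change _ ≤ vpSum lam p x at hterm
  rw [vpSum_eq_ofReal_vpNorm_rpow hp hx,
    ENNReal.ofReal_le_ofReal_iff (Real.rpow_nonneg (vpNorm_nonneg _ _ _) p),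
    Real.rpow_le_rpow_iff (mul_nonneg (inv_pos.2 hl).le
      (Finset.sum_nonneg fun j _ => abs_nonneg _)) (vpNorm_nonneg _ _ _) hp,
    inv_mul_le_iff₀ hl] at hterm
  refine le_trans (Finset.single_le_sum (f := fun j => |x j|) (fun j _ => abs_nonneg _) ?_) hterm
  simp only [vpWindow, Finset.mem_filter, Finset.mem_Icc]
  exact ⟨⟨hj, le_rfl⟩, by linarith⟩

/-- Lower semicontinuity of the modular under coordinatewise convergence. -/
theorem vpSum_le_of_tendsto {lam : ℕ → ℝ} {p : ℝ} (hp : 0 ≤ p) {ι : Type*} {l : Filter ι}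
    [l.NeBot] {u : ι → ℕ → ℝ} {v : ℕ → ℝ} {c : ℝ≥0∞}
    (huv : ∀ j, 1 ≤ j → Tendsto (fun i => u i j) l (nhds (v j)))
    (hu : ∀ᶠ i in l, vpSum lam p (u i) ≤ c) : vpSum lam p v ≤ c := by
  unfold vpSum
  rw [ENNReal.tsum_eq_iSup_sum]
  refine iSup_le fun s => ?_
  refine le_of_tendsto (f := fun i => ∑ k ∈ s, ENNReal.ofReal
    (((lam (k + 1))⁻¹ * ∑ j ∈ vpWindow lam (k + 1), |u i j|) ^ p))
    (tendsto_finsetSum s fun k _ => ENNReal.tendsto_ofReal ?_)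
    (hu.mono fun i hi => (ENNReal.sum_le_tsum s).trans hi)
  refine Tendsto.rpow_const (Tendsto.const_mul _ (tendsto_finsetSum _ fun j hj => ?_)) (Or.inr hp)
  exact (huv j (Finset.mem_Icc.1 (Finset.mem_filter.1 hj).1).1).abs

/-- `V_p(λ)` is complete with respect to its norm. -/
theorem vpNorm_complete (lam : ℕ → ℝ) (p : ℝ)
    (hlam1 : lam 1 = 1)
    (hlam_pos : ∀ k : ℕ, 1 ≤ k → 0 < lam k)
    (hlam_mono : ∀ k : ℕ, 1 ≤ k → lam k ≤ lam (k + 1))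
    (hlam_step : ∀ k : ℕ, 1 ≤ k → lam (k + 1) ≤ lam k + 1)
    (hlam_top : Tendsto lam atTop atTop)
    (hp : 1 < p)
    (xs : ℕ → ℕ → ℝ) (hxs : ∀ n, vpSum lam p (xs n) < ⊤)
    (hcauchy : ∀ ε : ℝ, 0 < ε → ∃ N : ℕ, ∀ m n : ℕ, N ≤ m → N ≤ n →
      vpNorm lam p (xs n - xs m) < ε) :
    ∃ x : ℕ → ℝ, vpSum lam p x < ⊤ ∧
      Tendsto (fun n => vpNorm lam p (xs n - x)) atTop (nhds 0) := by
  have hp0 : 0 < p := zero_lt_one.trans hp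
  have hlam_one : ∀ k : ℕ, 1 ≤ k → 1 ≤ lam k := fun k hk =>
    Nat.le_induction hlam1.ge (fun k hk ih => ih.trans (hlam_mono k hk)) k hk
  have hdiff : ∀ m n, vpSum lam p (xs n - xs m) < ⊤ := fun m n =>
    vpSum_sub_lt_top hlam_pos hp.le (hxs n) (hxs m)
  have hcoord : ∀ j, ∃ a, 1 ≤ j → Tendsto (fun n => xs n j) atTop (nhds a) := by
    intro j
    by_cases hj : 1 ≤ j
    · have hcs : CauchySeq fun n => xs n j := by
        refine Metric.cauchySeq_iff.2 fun ε hε => ?_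
        obtain ⟨N, hN⟩ := hcauchy (ε / lam j) (div_pos hε (hlam_pos j hj))
        refine ⟨N, fun n hn m hm => ?_⟩
        rw [Real.dist_eq]
        exact (abs_le_mul_vpNorm hp0 (hdiff m n) hj (hlam_one j hj)).trans_lt
          ((lt_div_iff₀' (hlam_pos j hj)).1 (hN m n hm hn))
      obtain ⟨a, ha⟩ := cauchySeq_tendsto_of_complete hcs
      exact ⟨a, fun _ => ha⟩
    · exact ⟨0, fun h => absurd h hj⟩
  choose x hx using hcoord
  have hlim : ∀ ε : ℝ, 0 < ε → ∃ N : ℕ, ∀ n, N ≤ n →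
      vpSum lam p (xs n - x) ≤ ENNReal.ofReal (ε ^ p) := by
    intro ε hε
    obtain ⟨N, hN⟩ := hcauchy ε hε
    refine ⟨N, fun n hn => vpSum_le_of_tendsto (l := atTop) (u := fun m => xs n - xs m) hp0.le
      (fun j hj => (hx j hj).const_sub (xs n j)) ?_⟩
    filter_upwards [eventually_ge_atTop N] with m hm
    rw [vpSum_eq_ofReal_vpNorm_rpow hp0 (hdiff m n)]
    exact ENNReal.ofReal_le_ofReal
      (Real.rpow_le_rpow (vpNorm_nonneg _ _ _) (hN m n hm hn).le hp0.le)
  refine ⟨x, ?_, ?_⟩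
  · obtain ⟨N, hN⟩ := hlim 1 one_pos
    rw [← sub_sub_cancel (xs N) x]
    exact vpSum_sub_lt_top hlam_pos hp.le (hxs N) ((hN N le_rfl).trans_lt ENNReal.ofReal_lt_top)
  · refine Metric.tendsto_atTop.2 fun ε hε => ?_
    obtain ⟨N, hN⟩ := hlim (ε / 2) (half_pos hε)
    refine ⟨N, fun n hn => ?_⟩
    rw [Real.dist_0_eq_abs, abs_of_nonneg (vpNorm_nonneg _ _ _)]
    exact (vpNorm_le_of_vpSum_le hp0 (half_pos hε).le (hN n hn)).trans_lt (half_lt_self hε)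
end

section
/- For any x ∈ V_ρ(λ;p), one has ‖x‖_L = 1 if and only if ρ(x) = 1. -/
open Filter
open scoped BigOperators ENNReal

/-- Membership in `V_ρ(λ;p) = {x : ρ(t x) < ∞ for some t > 0}`. -/
def memVrho (lam pp : ℕ → ℝ) (x : ℕ → ℝ) : Prop :=
  ∃ t : ℝ, 0 < t ∧ vpModular lam pp (t • x) < ⊤

/-- The Luxemburg norm `‖x‖_L = inf {t > 0 : ρ(x/t) ≤ 1}`. -/
noncomputable def luxNorm (lam pp : ℕ → ℝ) (x : ℕ → ℝ) : ℝ :=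
  sInf {t : ℝ | 0 < t ∧ vpModular lam pp (t⁻¹ • x) ≤ 1}

theorem vpModular_smul_le {lam pp : ℕ → ℝ} (hlam_pos : ∀ k : ℕ, 1 ≤ k → 0 < lam k)
    {c K : ℝ} (hc : 0 ≤ c) (hK : ∀ k : ℕ, c ^ pp (k + 1) ≤ K) (x : ℕ → ℝ) :
    vpModular lam pp (c • x) ≤ ENNReal.ofReal K * vpModular lam pp x := by
  have hK0 : 0 ≤ K := (Real.rpow_nonneg hc _).trans (hK 0)
  unfold vpModular
  rw [← ENNReal.tsum_mul_left]
  refine ENNReal.tsum_le_tsum fun k => ?_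
  rw [← ENNReal.ofReal_mul hK0]
  refine ENNReal.ofReal_le_ofReal ?_
  have hmean : 0 ≤ (lam (k + 1))⁻¹ * ∑ j ∈ vpWindow lam (k + 1), |x j| :=
    mul_nonneg (inv_nonneg.2 (hlam_pos _ (Nat.le_add_left 1 k)).le)
      (Finset.sum_nonneg fun _ _ => abs_nonneg _)
  have hscale : (lam (k + 1))⁻¹ * ∑ j ∈ vpWindow lam (k + 1), |(c • x) j|
      = c * ((lam (k + 1))⁻¹ * ∑ j ∈ vpWindow lam (k + 1), |x j|) := by
    simp only [Pi.smul_apply, smul_eq_mul, abs_mul, abs_of_nonneg hc, ← Finset.mul_sum]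
    ring
  rw [hscale, Real.mul_rpow hc hmean]
  exact mul_le_mul_of_nonneg_right (hK k) (Real.rpow_nonneg hmean _)

/-- `‖x‖_L = 1` if and only if `ρ(x) = 1`. -/
theorem luxNorm_eq_one_iff (lam pp : ℕ → ℝ)
    (hlam1 : lam 1 = 1)
    (hlam_pos : ∀ k : ℕ, 1 ≤ k → 0 < lam k)
    (hlam_mono : ∀ k : ℕ, 1 ≤ k → lam k ≤ lam (k + 1))
    (hlam_step : ∀ k : ℕ, 1 ≤ k → lam (k + 1) ≤ lam k + 1)
    (hlam_top : Tendsto lam atTop atTop)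
    (hp_gt : ∀ k : ℕ, 1 ≤ k → 1 < pp k)
    (hp_bdd : BddAbove (Set.range fun k : ℕ => pp (k + 1)))
    (x : ℕ → ℝ) (hx : memVrho lam pp x) :
    luxNorm lam pp x = 1 ↔ vpModular lam pp x = 1 := by
  obtain ⟨M, hM⟩ := hp_bdd
  have hM' : ∀ k : ℕ, pp (k + 1) ≤ M := fun k => hM ⟨k, rfl⟩
  have hexpand : ∀ c : ℝ, 1 ≤ c → ∀ y : ℕ → ℝ,
      vpModular lam pp (c • y) ≤ ENNReal.ofReal (c ^ M) * vpModular lam pp y := fun c hc y =>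
    vpModular_smul_le hlam_pos (zero_le_one.trans hc)
      (fun k => Real.rpow_le_rpow_of_exponent_le hc (hM' k)) y
  have hcontract : ∀ c : ℝ, 0 < c → c ≤ 1 → ∀ y : ℕ → ℝ,
      vpModular lam pp (c • y) ≤ ENNReal.ofReal c * vpModular lam pp y := fun c hc hc1 y =>
    vpModular_smul_le hlam_pos hc.le (fun k => by
      simpa using Real.rpow_le_rpow_of_exponent_ge hc hc1 (hp_gt _ (Nat.le_add_left 1 k)).le) y
  have hlim : Tendsto (fun c : ℝ => ENNReal.ofReal (c ^ M)) (nhdsWithin 1 (Set.Ioi 1))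
      (nhds 1) := by
    have h : ContinuousAt (fun c : ℝ => ENNReal.ofReal (c ^ M)) 1 :=
      ENNReal.continuous_ofReal.continuousAt.comp
        (Real.continuousAt_rpow_const 1 M (Or.inl one_ne_zero))
    simpa using h.tendsto.mono_left nhdsWithin_le_nhds
  have hbdd : BddBelow {t : ℝ | 0 < t ∧ vpModular lam pp (t⁻¹ • x) ≤ 1} :=
    ⟨0, fun t ht => ht.1.le⟩
  unfold luxNorm
  constructor
  · intro hnorm
    have hne : {t : ℝ | 0 < t ∧ vpModular lam pp (t⁻¹ • x) ≤ 1}.Nonempty := by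
      by_contra hempty
      rw [Set.not_nonempty_iff_eq_empty.1 hempty, Real.sInf_empty] at hnorm
      exact zero_ne_one hnorm
    have hlower : ∀ t : ℝ, 0 < t → vpModular lam pp (t⁻¹ • x) ≤ 1 → 1 ≤ t := fun t ht ht1 =>
      hnorm ▸ csInf_le hbdd ⟨ht, ht1⟩
    have hle : vpModular lam pp x ≤ 1 := by
      refine ge_of_tendsto hlim ?_
      filter_upwards [self_mem_nhdsWithin] with c hc
      obtain ⟨s, ⟨hs0, hs⟩, hsc⟩ := exists_lt_of_csInf_lt hne (hnorm.trans_lt hc)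
      have hM0 : 0 ≤ M := by linarith [hM' 0, hp_gt 1 le_rfl]
      calc vpModular lam pp x = vpModular lam pp (s • s⁻¹ • x) := by
            rw [smul_inv_smul₀ hs0.ne']
        _ ≤ ENNReal.ofReal (s ^ M) * vpModular lam pp (s⁻¹ • x) :=
            hexpand s (hlower s hs0 hs) _
        _ ≤ ENNReal.ofReal (s ^ M) * 1 := by gcongr
        _ ≤ ENNReal.ofReal (c ^ M) := by
            rw [mul_one]
            exact ENNReal.ofReal_le_ofReal (Real.rpow_le_rpow hs0.le hsc.le hM0)
    refine hle.antisymm (not_lt.1 fun hlt => ?_)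
    have hlim' : Tendsto (fun c : ℝ => ENNReal.ofReal (c ^ M) * vpModular lam pp x)
        (nhdsWithin 1 (Set.Ioi 1)) (nhds (1 * vpModular lam pp x)) :=
      ENNReal.Tendsto.mul_const hlim (Or.inl one_ne_zero)
    rw [one_mul] at hlim'
    obtain ⟨c, hc1, hc⟩ :=
      ((hlim'.eventually (gt_mem_nhds hlt)).and self_mem_nhdsWithin).exists
    have hc : 1 < c := hc
    have h1 : 1 ≤ c⁻¹ := hlower c⁻¹ (by positivity) (by
      rw [inv_inv]
      exact (hexpand c hc.le x).trans hc1.le)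
    exact absurd (inv_lt_one_of_one_lt₀ hc) (not_lt.2 h1)
  · intro hmod
    refine IsLeast.csInf_eq ⟨⟨one_pos, by simp [hmod]⟩, fun t ht => ?_⟩
    obtain ⟨ht0, ht1⟩ := ht
    by_contra! hlt
    have h : vpModular lam pp x ≤ ENNReal.ofReal t := by
      calc vpModular lam pp x = vpModular lam pp (t • t⁻¹ • x) := by
            rw [smul_inv_smul₀ ht0.ne']
        _ ≤ ENNReal.ofReal t * vpModular lam pp (t⁻¹ • x) := hcontract t ht0 hlt.le _
        _ ≤ ENNReal.ofReal t * 1 := by gcongr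
        _ = ENNReal.ofReal t := mul_one _
    rw [hmod, ENNReal.one_le_ofReal] at h
    exact absurd hlt (not_lt.2 h)
end

section
/- Let (x_n) be a sequence in V_ρ(λ;p). If ‖x_n‖_L → 1 as n → ∞, then ρ(x_n) → 1 as n → ∞. -/
open Filter
open scoped BigOperators ENNReal

/-- Scaling by `s ≥ 0` increases the modular by a factor of at most `max 1 s ^ M`, where `M`
bounds the exponents. -/
theorem vpModular_smul_le_s9 {lam pp : ℕ → ℝ} {M s : ℝ} (hlam_pos : ∀ k : ℕ, 1 ≤ k → 0 < lam k)
    (hp : ∀ k : ℕ, 0 ≤ pp (k + 1)) (hM : ∀ k : ℕ, pp (k + 1) ≤ M) (hs : 0 ≤ s) (x : ℕ → ℝ) :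
    vpModular lam pp (s • x) ≤ ENNReal.ofReal (max 1 s ^ M) * vpModular lam pp x := by
  unfold vpModular
  rw [← ENNReal.tsum_mul_left]
  refine ENNReal.tsum_le_tsum fun k => ?_
  rw [← ENNReal.ofReal_mul (by positivity)]
  refine ENNReal.ofReal_le_ofReal ?_
  have hmean : 0 ≤ (lam (k + 1))⁻¹ * ∑ j ∈ vpWindow lam (k + 1), |x j| :=
    mul_nonneg (inv_nonneg.2 (hlam_pos _ k.succ_pos).le) (Finset.sum_nonneg fun _ _ => abs_nonneg _)
  have hscale : (lam (k + 1))⁻¹ * ∑ j ∈ vpWindow lam (k + 1), |(s • x) j|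
      = s * ((lam (k + 1))⁻¹ * ∑ j ∈ vpWindow lam (k + 1), |x j|) := by
    simp only [Pi.smul_apply, smul_eq_mul, abs_mul, abs_of_nonneg hs, ← Finset.mul_sum]
    ring
  rw [hscale, Real.mul_rpow hs hmean]
  refine mul_le_mul_of_nonneg_right ?_ (Real.rpow_nonneg hmean _)
  calc s ^ pp (k + 1) ≤ max 1 s ^ pp (k + 1) :=
        Real.rpow_le_rpow hs (le_max_right _ _) (hp k)
    _ ≤ max 1 s ^ M := Real.rpow_le_rpow_of_exponent_le (le_max_left _ _) (hM k)

/-- A positive Luxemburg norm smaller than `t` bounds the modular by `max 1 t ^ M`. -/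
theorem vpModular_le_of_luxNorm_lt {lam pp : ℕ → ℝ} {M t : ℝ}
    (hlam_pos : ∀ k : ℕ, 1 ≤ k → 0 < lam k) (hp : ∀ k : ℕ, 0 ≤ pp (k + 1))
    (hM : ∀ k : ℕ, pp (k + 1) ≤ M) (hM0 : 0 ≤ M) {x : ℕ → ℝ} (hx : 0 < luxNorm lam pp x)
    (hxt : luxNorm lam pp x < t) :
    vpModular lam pp x ≤ ENNReal.ofReal (max 1 t ^ M) := by
  have hne : {t : ℝ | 0 < t ∧ vpModular lam pp (t⁻¹ • x) ≤ 1}.Nonempty := by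
    by_contra hempty
    rw [Set.not_nonempty_iff_eq_empty] at hempty
    rw [luxNorm, hempty, Real.sInf_empty] at hx
    exact hx.false
  obtain ⟨u, ⟨hu, hux⟩, hut⟩ := exists_lt_of_csInf_lt hne hxt
  calc vpModular lam pp x = vpModular lam pp (u • u⁻¹ • x) := by
        rw [smul_inv_smul₀ hu.ne']
    _ ≤ ENNReal.ofReal (max 1 u ^ M) * vpModular lam pp (u⁻¹ • x) :=
        vpModular_smul_le_s9 hlam_pos hp hM hu.le _
    _ ≤ ENNReal.ofReal (max 1 u ^ M) := mul_le_of_le_one_right' hux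
    _ ≤ ENNReal.ofReal (max 1 t ^ M) := by gcongr

/-- A Luxemburg norm larger than `t > 0` bounds the modular below by `(max 1 t⁻¹ ^ M)⁻¹`. -/
theorem le_vpModular_of_lt_luxNorm {lam pp : ℕ → ℝ} {M t : ℝ}
    (hlam_pos : ∀ k : ℕ, 1 ≤ k → 0 < lam k) (hp : ∀ k : ℕ, 0 ≤ pp (k + 1))
    (hM : ∀ k : ℕ, pp (k + 1) ≤ M) {x : ℕ → ℝ} (ht : 0 < t) (htx : t < luxNorm lam pp x) :
    (ENNReal.ofReal (max 1 t⁻¹ ^ M))⁻¹ ≤ vpModular lam pp x := by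
  have hlt : 1 < vpModular lam pp (t⁻¹ • x) := by
    by_contra! hle
    exact htx.not_ge (csInf_le ⟨0, fun _ hu => hu.1.le⟩ ⟨ht, hle⟩)
  have hle := hlt.le.trans (vpModular_smul_le_s9 hlam_pos hp hM (inv_pos.2 ht).le x)
  have hpos : 0 < max 1 t⁻¹ ^ M := by positivity
  rw [ENNReal.inv_le_iff_le_mul (fun _ => (ENNReal.ofReal_pos.2 hpos).ne')
    (fun h => absurd h ENNReal.ofReal_ne_top)]
  exact hle

/-- If `‖x_n‖_L → 1`, then `ρ(x_n) → 1`. -/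
theorem vpModular_tendsto_one (lam pp : ℕ → ℝ)
    (hlam1 : lam 1 = 1)
    (hlam_pos : ∀ k : ℕ, 1 ≤ k → 0 < lam k)
    (hlam_mono : ∀ k : ℕ, 1 ≤ k → lam k ≤ lam (k + 1))
    (hlam_step : ∀ k : ℕ, 1 ≤ k → lam (k + 1) ≤ lam k + 1)
    (hlam_top : Tendsto lam atTop atTop)
    (hp_gt : ∀ k : ℕ, 1 ≤ k → 1 < pp k)
    (hp_bdd : BddAbove (Set.range fun k : ℕ => pp (k + 1)))
    (xs : ℕ → ℕ → ℝ) (hxs : ∀ n, memVrho lam pp (xs n))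
    (hnorm : Tendsto (fun n => luxNorm lam pp (xs n)) atTop (nhds 1)) :
    Tendsto (fun n => vpModular lam pp (xs n)) atTop (nhds 1) := by
  obtain ⟨M, hM⟩ := hp_bdd
  replace hM : ∀ k : ℕ, pp (k + 1) ≤ M := fun k => hM ⟨k, rfl⟩
  have hp : ∀ k : ℕ, 0 ≤ pp (k + 1) := fun k => (one_pos.trans (hp_gt _ k.succ_pos)).le
  have hM0 : 0 ≤ M := (hp 0).trans (hM 0)
  have hzero : Tendsto (fun n : ℕ => 1 / ((n : ℝ) + 1)) atTop (nhds 0) :=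
    tendsto_one_div_add_atTop_nhds_zero_nat
  have hpow : ∀ f : ℕ → ℝ, Tendsto f atTop (nhds 1) →
      Tendsto (fun n => ENNReal.ofReal (max 1 (f n) ^ M)) atTop (nhds 1) := by
    intro f hf
    have hmax : Tendsto (fun n => max 1 (f n) ^ M) atTop (nhds (max 1 1 ^ M)) :=
      (tendsto_const_nhds.max hf).rpow_const (Or.inr hM0)
    simpa using ENNReal.tendsto_ofReal hmax
  have hlow : Tendsto (fun n : ℕ => luxNorm lam pp (xs n) - 1 / ((n : ℝ) + 1)) atTop (nhds 1) := by
    simpa using hnorm.sub hzero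
  have hupp : Tendsto (fun n : ℕ => luxNorm lam pp (xs n) + 1 / ((n : ℝ) + 1)) atTop (nhds 1) := by
    simpa using hnorm.add hzero
  have hlower := (hpow _ (inv_one (G := ℝ) ▸ hlow.inv₀ one_ne_zero)).inv
  rw [inv_one] at hlower
  refine tendsto_of_tendsto_of_tendsto_of_le_of_le' hlower (hpow _ hupp) ?_ ?_
  · filter_upwards [hlow.eventually_const_lt one_pos] with n hn
    exact le_vpModular_of_lt_luxNorm hlam_pos hp hM hn (sub_lt_self _ Nat.one_div_pos_of_nat)
  · filter_upwards [hnorm.eventually_const_lt one_pos] with n hn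
    exact vpModular_le_of_luxNorm_lt hlam_pos hp hM hM0 hn
      (lt_add_of_pos_right _ Nat.one_div_pos_of_nat)
end
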